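/- Let (ε_k)_{k≥1} be positive reals with Σ_k ε_k ≤ 1. Then there exists a constant C > 1 such that: for every normalized block basis (y_k) of (e_i) in the Schlumprecht space S for which there is a sequence of integers r_k ↑ ∞ satisfying, for all k ∈ ℕ, (a) sup{ Σ_{i=1}^r ‖E_i y_k‖ : r ≤ r_{k-1}, E_1 < E_2 < ⋯ < E_r } ≤ 1 + ε_k and (b) card(supp y_k) ≤ ε_k · f(r_k / 3), the sequence (y_k) is C-equivalent to (e_k). -/

import Mathlib

open Filter Topology

noncomputable section

/-- `f(t) = log₂(t+1)`. -/
def schF (t : ℝ) : ℝ := Real.logb 2 (t + 1)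

/-- For a finitely supported scalar sequence `a`, the vector `Σᵢ aᵢ eᵢ`. -/
def embed {S : Type*} [NormedAddCommGroup S] [NormedSpace ℝ S] (e : ℕ → S) (a : ℕ →₀ ℝ) : S :=
  a.sum fun i c => c • e i

/-- The restriction `Ex` of `x = Σ aᵢ eᵢ` to the coordinates in the finite set `E`. -/
def restr (a : ℕ →₀ ℝ) (E : Finset ℕ) : ℕ →₀ ℝ := a.filter (· ∈ E)

/-- `E₁ < E₂ < ⋯ < E_r` : a successive family of finite subsets of ℕ. -/
def Succ {r : ℕ} (E : Fin r → Finset ℕ) : Prop :=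
  ∀ i j : Fin r, i < j → ∀ m ∈ E i, ∀ n ∈ E j, m < n

/-- `S` is (a realization of) the Schlumprecht space with unit vector basis `e`:
a Banach space in which the span of `e` is dense and whose norm satisfies, on the
finitely supported vectors `Σ aᵢ eᵢ`, the implicit Schlumprecht equation. -/
structure IsSchlumprecht (S : Type*) [NormedAddCommGroup S] [NormedSpace ℝ S] (e : ℕ → S) :
    Prop where
  dense_span : Dense (Submodule.span ℝ (Set.range e) : Set S)
  norm_eq : ∀ a : ℕ →₀ ℝ,
    ‖embed e a‖ = max (⨆ i, |a i|)
      (sSup {c : ℝ | ∃ r : ℕ, 2 ≤ r ∧ ∃ E : Fin r → Finset ℕ, Succ E ∧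
        c = (schF r)⁻¹ * ∑ i, ‖embed e (restr a (E i))‖})

/-- `b` is a normalized block basis of the unit vector basis `e`. -/
def IsNormalizedBlockBasis {S : Type*} [NormedAddCommGroup S] [NormedSpace ℝ S] (e : ℕ → S)
    (b : ℕ → ℕ →₀ ℝ) : Prop :=
  (∀ k, b k ≠ 0) ∧ (∀ k, ∀ m ∈ (b k).support, ∀ n ∈ (b (k + 1)).support, m < n) ∧
  (∀ k, ‖embed e (b k)‖ = 1)

/-- The series `Σ g k` converges to `s` (convergence of partial sums). -/
def SeriesSum {S : Type*} [AddCommMonoid S] [TopologicalSpace S] (g : ℕ → S) (s : S) : Prop :=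
  Tendsto (fun m => ∑ k ∈ Finset.range m, g k) atTop (𝓝 s)

/-- `V` is isomorphic (linearly homeomorphic) to the S-sum `(Σₖ ⊕ X k)_S`,
where the S-sum consists of all `y : Π k, X k` such that `Σₖ ‖y k‖ e k` converges in `S`,
normed by `‖Σₖ ‖y k‖ e k‖`. -/
def IsoToSSum {S : Type*} [NormedAddCommGroup S] [NormedSpace ℝ S] (e : ℕ → S)
    (V : Type*) [NormedAddCommGroup V] [Module ℝ V]
    (X : ℕ → Type*) [∀ k, NormedAddCommGroup (X k)] [∀ k, Module ℝ (X k)] : Prop :=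
  ∃ (T : V →ₗ[ℝ] Π k, X k) (A B : ℝ), 0 < A ∧ 0 < B ∧
    (Set.range T = {y | ∃ s : S, SeriesSum (fun k => ‖y k‖ • e k) s}) ∧
    ∀ v : V, ∃ s : S, SeriesSum (fun k => ‖T v k‖ • e k) s ∧
      A * ‖v‖ ≤ ‖s‖ ∧ ‖s‖ ≤ B * ‖v‖

section Schlumprecht

lemma schF_one : schF 1 = 1 := by
  have : Real.logb 2 2 = 1 := Real.logb_self_eq_one (by norm_num)
  unfold schF
  norm_num [this]

lemma schF_le_schF {s t : ℝ} (hs : 0 ≤ s) (hst : s ≤ t) : schF s ≤ schF t :=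
  Real.logb_le_logb_of_le (by norm_num) (by linarith) (by linarith)

lemma one_le_schF {t : ℝ} (ht : 1 ≤ t) : 1 ≤ schF t := by
  simpa [schF_one] using schF_le_schF zero_le_one ht

lemma three_halves_le_schF {t : ℝ} (ht : 2 ≤ t) : 3 / 2 ≤ schF t := by
  refine le_trans ?_ (schF_le_schF (by norm_num) ht)
  unfold schF
  rw [Real.le_logb_iff_rpow_le (by norm_num) (by norm_num)]
  have h : ((2 : ℝ) ^ (3 / 2 : ℝ)) ^ 2 = 8 := by
    rw [← Real.rpow_natCast, ← Real.rpow_mul (by norm_num)]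
    norm_num
  have h0 : (0 : ℝ) ≤ 2 ^ (3 / 2 : ℝ) := by positivity
  nlinarith

/-- A family of finite sets of which any two distinct members are successive, in some order. -/
def Separated {ι : Type*} (I : Finset ι) (B : ι → Finset ℕ) : Prop :=
  ∀ i ∈ I, ∀ j ∈ I, i ≠ j →
    (∀ m ∈ B i, ∀ n ∈ B j, m < n) ∨ ∀ m ∈ B i, ∀ n ∈ B j, n < m

lemma Separated.mono {ι : Type*} {I J : Finset ι} {B : ι → Finset ℕ} (h : Separated I B)
    (hJ : J ⊆ I) : Separated J B :=
  fun i hi j hj => h i (hJ hi) j (hJ hj)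

/-- A separated family can be enumerated as a successive one. -/
lemma Separated.exists_succ {ι : Type*} {I : Finset ι} {B : ι → Finset ℕ}
    (h : Separated I B) :
    ∃ E : Fin I.card → Finset ℕ, Succ E ∧
      ∀ F : Finset ℕ → ℝ, ∑ i ∈ I, F (B i) = ∑ j, F (E j) := by
  let g : Fin I.card → ι := fun j => I.equivFin.symm j
  let key : Fin I.card → ℕ := fun j => (B (g j)).sup id
  let σ := Tuple.sort key
  have hσ : Monotone (key ∘ σ) := Tuple.monotone_sort key
  refine ⟨fun j => B (g (σ j)), ?_, fun F => ?_⟩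
  · intro i j hij m hm n hn
    have hne : g (σ i) ≠ g (σ j) := fun hg =>
      hij.ne (σ.injective (I.equivFin.symm.injective (Subtype.ext hg)))
    rcases h _ (I.equivFin.symm (σ i)).2 _ (I.equivFin.symm (σ j)).2 hne with h1 | h1
    · exact h1 m hm n hn
    · exfalso
      have h2 : (B (g (σ i))).sup id ≤ (B (g (σ j))).sup id := hσ hij.le
      obtain ⟨p, hp, hpe⟩ := Finset.exists_mem_eq_sup (B (g (σ j))) ⟨n, hn⟩ id
      have h3 : m ≤ (B (g (σ i))).sup id := Finset.le_sup (f := id) hm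
      have h4 := h1 m hm p hp
      simp only [id] at hpe
      omega
  · rw [← Finset.sum_coe_sort I, ← Equiv.sum_comp I.equivFin.symm, ← Equiv.sum_comp σ]

variable {S : Type*} [NormedAddCommGroup S] [NormedSpace ℝ S] {e : ℕ → S}

lemma embed_eq (e : ℕ → S) (a : ℕ →₀ ℝ) : embed e a = Finsupp.linearCombination ℝ e a := rfl

lemma embed_zero : embed e 0 = 0 := by simp [embed]

lemma restr_apply (a : ℕ →₀ ℝ) (E : Finset ℕ) (i : ℕ) :
    restr a E i = if i ∈ E then a i else 0 := by
  simp [restr, Finsupp.filter_apply]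

lemma support_restr (a : ℕ →₀ ℝ) (E : Finset ℕ) :
    (restr a E).support = a.support ∩ E := by
  ext i
  simp [restr_apply]
  tauto

lemma restr_restr (a : ℕ →₀ ℝ) (E F : Finset ℕ) : restr (restr a E) F = restr a (F ∩ E) := by
  ext i
  simp only [restr_apply, Finset.mem_inter]
  split_ifs <;> tauto

lemma restr_eq_self {a : ℕ →₀ ℝ} {E : Finset ℕ} (h : a.support ⊆ E) : restr a E = a := by
  ext i
  rw [restr_apply]
  split_ifs with hi
  · rfl
  · by_contra h0
    exact hi (h (Finsupp.mem_support_iff.2 (Ne.symm h0)))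

lemma restr_eq_zero {a : ℕ →₀ ℝ} {E : Finset ℕ} (h : ∀ i ∈ E, a i = 0) : restr a E = 0 := by
  ext i
  rw [restr_apply]
  split_ifs with hi
  · simp [h i hi]
  · rfl

lemma norm_embed_restr_le (a : ℕ →₀ ℝ) (E : Finset ℕ) :
    ‖embed e (restr a E)‖ ≤ ∑ m ∈ a.support ∩ E, |a m| * ‖e m‖ := by
  unfold embed
  rw [Finsupp.sum, support_restr]
  refine (norm_sum_le _ _).trans (Finset.sum_le_sum fun m hm => ?_)
  rw [restr_apply, if_pos (Finset.mem_inter.1 hm).2, norm_smul, Real.norm_eq_abs]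

lemma Succ.inter {r : ℕ} {E : Fin r → Finset ℕ} (h : Succ E) (F : Finset ℕ) :
    Succ fun i => E i ∩ F :=
  fun i j hij m hm n hn => h i j hij m (Finset.mem_inter.1 hm).1 n (Finset.mem_inter.1 hn).1

lemma Succ.disjoint {r : ℕ} {E : Fin r → Finset ℕ} (h : Succ E) {i j : Fin r} (hij : i ≠ j) :
    Disjoint (E i) (E j) := by
  rw [Finset.disjoint_left]
  intro m hi hj
  rcases lt_or_gt_of_ne hij with h1 | h1
  · exact lt_irrefl _ (h _ _ h1 m hi m hj)
  · exact lt_irrefl _ (h _ _ h1 m hj m hi)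

lemma Succ.sum_norm_restr_le {r : ℕ} {E : Fin r → Finset ℕ} (h : Succ E) (a : ℕ →₀ ℝ) :
    ∑ i, ‖embed e (restr a (E i))‖ ≤ ∑ m ∈ a.support, |a m| * ‖e m‖ := by
  refine (Finset.sum_le_sum fun i _ => norm_embed_restr_le a (E i)).trans ?_
  rw [← Finset.sum_biUnion]
  · refine Finset.sum_le_sum_of_subset_of_nonneg ?_ fun m _ _ => by positivity
    simp only [Finset.biUnion_subset_iff_forall_subset]
    exact fun i _ => Finset.inter_subset_left
  · intro i _ j _ hij
    exact (h.disjoint hij).mono Finset.inter_subset_right Finset.inter_subset_right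

lemma bddAbove_range_abs (a : ℕ →₀ ℝ) : BddAbove (Set.range fun i => |a i|) := by
  refine ⟨∑ m ∈ a.support, |a m|, ?_⟩
  rintro _ ⟨i, rfl⟩
  by_cases hi : i ∈ a.support
  · exact Finset.single_le_sum (f := fun m => |a m|) (fun _ _ => abs_nonneg _) hi
  · simp only [Finsupp.notMem_support_iff.1 hi, abs_zero]
    positivity

namespace IsSchlumprecht

lemma abs_le_norm (hS : IsSchlumprecht S e) (a : ℕ →₀ ℝ) (i : ℕ) : |a i| ≤ ‖embed e a‖ := by
  rw [hS.norm_eq]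
  exact (le_ciSup (bddAbove_range_abs a) i).trans (le_max_left _ _)

lemma sum_norm_restr_le (hS : IsSchlumprecht S e) (a : ℕ →₀ ℝ) {r : ℕ} (hr : 2 ≤ r)
    {E : Fin r → Finset ℕ} (hE : Succ E) :
    (schF r)⁻¹ * ∑ i, ‖embed e (restr a (E i))‖ ≤ ‖embed e a‖ := by
  conv_rhs => rw [hS.norm_eq]
  refine le_trans (le_csSup (?_ : BddAbove _) ?_) (le_max_right _ _)
  swap
  · exact ⟨r, hr, E, hE, rfl⟩
  refine ⟨∑ m ∈ a.support, |a m| * ‖e m‖, ?_⟩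
  rintro c ⟨r, hr, E, hE, rfl⟩
  have h1 : 1 ≤ schF r := one_le_schF (by exact_mod_cast (by omega : 1 ≤ r))
  calc (schF r)⁻¹ * ∑ i, ‖embed e (restr a (E i))‖
      ≤ 1 * ∑ i, ‖embed e (restr a (E i))‖ := by
        gcongr
        exact inv_le_one_of_one_le₀ h1
    _ ≤ _ := by rw [one_mul]; exact hE.sum_norm_restr_le a

/-- The norm of a finitely supported vector is almost attained, either at a coordinate or at a
successive family none of whose members covers the support. -/
lemma norm_approx (hS : IsSchlumprecht S e) (a : ℕ →₀ ℝ) {δ : ℝ} (hδ : 0 < δ) :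
    (∃ i, ‖embed e a‖ ≤ |a i| + δ) ∨
      ∃ r : ℕ, 2 ≤ r ∧ ∃ E : Fin r → Finset ℕ, Succ E ∧ (∀ i, ¬ a.support ⊆ E i) ∧
        ‖embed e a‖ ≤ (schF r)⁻¹ * ∑ i, ‖embed e (restr a (E i))‖ + δ := by
  by_cases ha : a = 0
  · left
    refine ⟨0, ?_⟩
    simp [ha, embed_zero, hδ.le]
  obtain ⟨i, hi⟩ := Finsupp.ne_iff.1 ha
  have hpos : 0 < ‖embed e a‖ := (abs_pos.2 hi).trans_le (hS.abs_le_norm a i)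
  set δ' := min δ (‖embed e a‖ / 4) with hδ'
  have hδ'0 : 0 < δ' := lt_min hδ (by linarith)
  have hδ'1 : δ' ≤ δ := min_le_left _ _
  have hδ'2 : δ' ≤ ‖embed e a‖ / 4 := min_le_right _ _
  have hlt : ‖embed e a‖ - δ' < ‖embed e a‖ := by linarith
  conv_rhs at hlt => rw [hS.norm_eq a]
  rcases lt_max_iff.1 hlt with h | h
  · obtain ⟨j, hj⟩ := exists_lt_of_lt_ciSup h
    exact Or.inl ⟨j, by linarith⟩
  · right
    obtain ⟨_, ⟨r, hr, E, hE, rfl⟩, hc⟩ :=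
      exists_lt_of_lt_csSup (by
        by_contra h0
        rw [Set.not_nonempty_iff_eq_empty.1 h0, Real.sSup_empty] at h
        linarith) h
    refine ⟨r, hr, E, hE, fun i hi => ?_, by linarith⟩
    have hsum : ∑ j, ‖embed e (restr a (E j))‖ = ‖embed e a‖ := by
      rw [Finset.sum_eq_single i, restr_eq_self hi]
      · intro j _ hj
        rw [restr_eq_zero, embed_zero, norm_zero]
        intro m hm
        by_contra h0
        exact Finset.disjoint_left.1 (hE.disjoint hj) hm (hi (Finsupp.mem_support_iff.2 h0))
      · simp
    rw [hsum] at hc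
    have h32 : 3 / 2 ≤ schF r := three_halves_le_schF (by exact_mod_cast hr)
    have : (schF r)⁻¹ ≤ 2 / 3 := by
      rw [inv_le_comm₀ (by linarith) (by norm_num)]
      norm_num
      exact h32
    nlinarith

lemma norm_restr_le (hS : IsSchlumprecht S e) (a : ℕ →₀ ℝ) (E : Finset ℕ) :
    ‖embed e (restr a E)‖ ≤ ‖embed e a‖ := by
  refine le_of_forall_pos_le_add fun δ hδ => ?_
  rcases hS.norm_approx (restr a E) hδ with ⟨i, hi⟩ | ⟨r, hr, D, hD, -, h⟩
  · refine hi.trans (add_le_add_left (le_trans ?_ (hS.abs_le_norm a i)) _)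
    rw [restr_apply]
    split_ifs <;> simp
  · refine h.trans (add_le_add_left ?_ _)
    simp only [restr_restr]
    exact hS.sum_norm_restr_le a hr (hD.inter E)

lemma norm_restr_mono (hS : IsSchlumprecht S e) (a : ℕ →₀ ℝ) {E F : Finset ℕ} (h : E ⊆ F) :
    ‖embed e (restr a E)‖ ≤ ‖embed e (restr a F)‖ := by
  have := hS.norm_restr_le (restr a F) E
  rwa [restr_restr, Finset.inter_eq_left.2 h] at this

lemma sum_norm_restr_le_of_separated (hS : IsSchlumprecht S e) (a : ℕ →₀ ℝ) {ι : Type*}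
    {I : Finset ι} {B : ι → Finset ℕ} (hB : Separated I B) {A : Finset ℕ}
    (hA : ∀ i ∈ I, B i ⊆ A) {t : ℝ} (ht : 1 ≤ t) (hI : (I.card : ℝ) ≤ t) :
    ∑ i ∈ I, ‖embed e (restr a (B i))‖ ≤ schF t * ‖embed e (restr a A)‖ := by
  have ht1 := one_le_schF ht
  rcases Nat.lt_or_ge I.card 2 with hc | hc
  · refine le_trans ?_ (le_mul_of_one_le_left (norm_nonneg _) ht1)
    have : I.card = 0 ∨ I.card = 1 := by omega
    rcases this with h | h
    · rw [Finset.card_eq_zero.1 h]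
      simp
    · obtain ⟨i, rfl⟩ := Finset.card_eq_one.1 h
      simpa using hS.norm_restr_mono a (hA i (by simp))
  · obtain ⟨E, hE, hsum⟩ := hB.exists_succ
    have h1 : ∑ i ∈ I, ‖embed e (restr a (B i))‖ =
        ∑ j, ‖embed e (restr (restr a A) (E j))‖ := by
      simp only [restr_restr]
      rw [← hsum fun F => ‖embed e (restr a (F ∩ A))‖]
      exact Finset.sum_congr rfl fun i hi => by rw [Finset.inter_eq_left.2 (hA i hi)]
    have h2 := hS.sum_norm_restr_le (restr a A) hc hE
    have h3 : 0 < schF I.card :=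
      one_pos.trans_le (one_le_schF (by exact_mod_cast (by omega : 1 ≤ I.card)))
    rw [inv_mul_le_iff₀ h3] at h2
    rw [h1]
    exact h2.trans (by gcongr; exact schF_le_schF (by positivity) hI)

lemma norm_basis_le_one (hS : IsSchlumprecht S e) (m : ℕ) : ‖e m‖ ≤ 1 := by
  have he : embed e (Finsupp.single m 1) = e m := by simp [embed]
  rw [← he]
  refine le_of_forall_pos_le_add fun δ hδ => ?_
  rcases hS.norm_approx (Finsupp.single m 1) hδ with ⟨i, hi⟩ | ⟨r, hr, E, hE, hsupp, h⟩
  · refine hi.trans (add_le_add_left ?_ _)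
    rw [Finsupp.single_apply]
    split_ifs <;> simp
  · have h0 : ∀ i, embed e (restr (Finsupp.single m 1) (E i)) = 0 := by
      intro i
      rw [restr_eq_zero, embed_zero]
      intro j hj
      rw [Finsupp.single_apply, if_neg]
      rintro rfl
      exact hsupp i (Finsupp.support_single_subset.trans (by simpa using hj))
    simp only [h0, norm_zero, Finset.sum_const_zero, mul_zero, zero_add] at h
    rw [he] at h ⊢
    linarith

lemma sum_norm_restr_le_card (hS : IsSchlumprecht S e) (a : ℕ →₀ ℝ) (ha : ‖embed e a‖ ≤ 1)
    {r : ℕ} {E : Fin r → Finset ℕ} (hE : Succ E) :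
    ∑ i, ‖embed e (restr a (E i))‖ ≤ a.support.card := by
  refine (hE.sum_norm_restr_le a).trans ?_
  rw [Finset.card_eq_sum_ones, Nat.cast_sum]
  refine Finset.sum_le_sum fun m _ => ?_
  rw [Nat.cast_one]
  exact mul_le_one₀ ((hS.abs_le_norm a m).trans ha) (norm_nonneg _) (hS.norm_basis_le_one m)

end IsSchlumprecht

lemma Separated.disjoint {ι : Type*} {I : Finset ι} {B : ι → Finset ℕ} (h : Separated I B)
    {i j : ι} (hi : i ∈ I) (hj : j ∈ I) (hij : i ≠ j) : Disjoint (B i) (B j) := by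
  rw [Finset.disjoint_left]
  intro m h1 h2
  rcases h i hi j hj hij with h3 | h3
  · exact lt_irrefl _ (h3 m h1 m h2)
  · exact lt_irrefl _ (h3 m h1 m h2)

lemma Separated.subset {ι : Type*} {I : Finset ι} {B D : ι → Finset ℕ} (h : Separated I B)
    (hD : ∀ i ∈ I, D i ⊆ B i) : Separated I D := by
  intro i hi j hj hij
  rcases h i hi j hj hij with h1 | h1
  · exact Or.inl fun m hm n hn => h1 m (hD i hi hm) n (hD j hj hn)
  · exact Or.inr fun m hm n hn => h1 m (hD i hi hm) n (hD j hj hn)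

/-- Separated families refining the members of a separated family form a separated family. -/
lemma Separated.sigma {ι : Type*} {κ : ι → Type*} {I : Finset ι} {B : ι → Finset ℕ}
    (h : Separated I B) {J : ∀ i, Finset (κ i)} {D : ∀ i, κ i → Finset ℕ}
    (hJ : ∀ i ∈ I, Separated (J i) (D i)) (hD : ∀ i ∈ I, ∀ j ∈ J i, D i j ⊆ B i) :
    Separated (I.sigma J) fun p => D p.1 p.2 := by
  rintro ⟨i, j⟩ hp ⟨i', j'⟩ hq hne
  rw [Finset.mem_sigma] at hp hq
  by_cases hi : i = i'
  · subst hi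
    exact hJ i hp.1 j hp.2 j' hq.2 fun h => hne (by rw [h])
  · rcases h i hp.1 i' hq.1 hi with h1 | h1
    · exact Or.inl fun m hm n hn => h1 m (hD _ hp.1 _ hp.2 hm) n (hD _ hq.1 _ hq.2 hn)
    · exact Or.inr fun m hm n hn => h1 m (hD _ hp.1 _ hp.2 hm) n (hD _ hq.1 _ hq.2 hn)

/-- The values on `w`, restricted to a finite set, of the tree functionals in which a node of
weight `1 / f(s)` may have up to `4 * s` children. -/
inductive TreeValue (w : ℕ → ℝ) : Finset ℕ → ℝ → Prop
  | zero (A : Finset ℕ) : TreeValue w A 0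
  | leaf (A : Finset ℕ) (k : ℕ) (hk : k ∈ A) : TreeValue w A (w k)
  | node (A : Finset ℕ) (s : ℕ) (hs : 2 ≤ s) (ι : Type) (I : Finset ι) (B : ι → Finset ℕ)
      (c : ι → ℝ) (hI : I.card ≤ 4 * s) (hB : Separated I B) (hA : ∀ i ∈ I, B i ⊆ A)
      (hc : ∀ i ∈ I, TreeValue w (B i) (c i)) : TreeValue w A ((schF s)⁻¹ * ∑ i ∈ I, c i)

/-- The tree values that come from trees whose root, if it is not a leaf, is a node of weight
`1 / f(s)` with `f(s) ≥ x`. -/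
def LargeTreeValue (w : ℕ → ℝ) (x : ℝ) (A : Finset ℕ) (c : ℝ) : Prop :=
  c = 0 ∨ (∃ k ∈ A, c = w k) ∨
    ∃ s : ℕ, 2 ≤ s ∧ x ≤ schF s ∧ ∃ (ι : Type) (I : Finset ι) (B : ι → Finset ℕ) (d : ι → ℝ),
      I.card ≤ 4 * s ∧ Separated I B ∧ (∀ i ∈ I, B i ⊆ A) ∧
      (∀ i ∈ I, TreeValue w (B i) (d i)) ∧ c = (schF s)⁻¹ * ∑ i ∈ I, d i

lemma schF_natCast_pos {s : ℕ} (hs : 2 ≤ s) : 0 < schF s :=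
  lt_of_lt_of_le (by norm_num) (three_halves_le_schF (by exact_mod_cast hs))

section TreeValue

variable {w : ℕ → ℝ} {A : Finset ℕ} {c x : ℝ}

lemma TreeValue.large (h : TreeValue w A c) : LargeTreeValue w 1 A c := by
  rcases h with _ | ⟨_, k, hk⟩ | ⟨_, s, hs, ι, I, B, c, hI, hB, hA, hc⟩
  · exact Or.inl rfl
  · exact Or.inr (Or.inl ⟨k, hk, rfl⟩)
  · exact Or.inr (Or.inr ⟨s, hs, one_le_schF (by exact_mod_cast (by omega : 1 ≤ s)),
      ι, I, B, c, hI, hB, hA, hc, rfl⟩)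

lemma LargeTreeValue.treeValue (h : LargeTreeValue w x A c) : TreeValue w A c := by
  rcases h with rfl | ⟨k, hk, rfl⟩ | ⟨s, hs, -, ι, I, B, c, hI, hB, hA, hc, rfl⟩
  · exact .zero A
  · exact .leaf A k hk
  · exact .node A s hs ι I B c hI hB hA hc

lemma TreeValue.nonneg (hw : ∀ k, 0 ≤ w k) (h : TreeValue w A c) : 0 ≤ c := by
  induction h with
  | zero A => exact le_rfl
  | leaf A k hk => exact hw k
  | node A s hs ι I B c hI hB hA hc ih =>
    exact mul_nonneg (inv_nonneg.2 (schF_natCast_pos hs).le) (Finset.sum_nonneg ih)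

lemma sum_sum_le_of_separated (hw : ∀ k, 0 ≤ w k) {ι : Type*} {I : Finset ι}
    {B : ι → Finset ℕ} (hB : Separated I B) (hA : ∀ i ∈ I, B i ⊆ A) :
    ∑ i ∈ I, ∑ k ∈ B i, w k ≤ ∑ k ∈ A, w k := by
  rw [← Finset.sum_biUnion fun i hi j hj hij => hB.disjoint hi hj hij]
  exact Finset.sum_le_sum_of_subset_of_nonneg (Finset.biUnion_subset.2 hA) fun k _ _ => hw k

lemma TreeValue.le_sum (hw : ∀ k, 0 ≤ w k) (h : TreeValue w A c) : c ≤ ∑ k ∈ A, w k := by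
  induction h with
  | zero A => exact Finset.sum_nonneg fun k _ => hw k
  | leaf A k hk => exact Finset.single_le_sum (fun k _ => hw k) hk
  | node A s hs ι I B c hI hB hA hc ih =>
    have h1 : ∑ i ∈ I, c i ≤ ∑ k ∈ A, w k :=
      (Finset.sum_le_sum ih).trans (sum_sum_le_of_separated hw hB hA)
    have h2 : 0 ≤ ∑ i ∈ I, c i := Finset.sum_nonneg fun i hi => (hc i hi).nonneg hw
    refine le_trans (mul_le_of_le_one_left h2 (inv_le_one_of_one_le₀ ?_)) h1
    exact one_le_schF (by exact_mod_cast (by omega : 1 ≤ s))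

/-- Tree values are subadditive with respect to the underlying set. -/
lemma TreeValue.exists_filter (p : ℕ → Prop) [DecidablePred p]
    (h : TreeValue w A c) :
    ∃ c₁ c₂, TreeValue w (A.filter p) c₁ ∧ TreeValue w (A.filter fun k => ¬ p k) c₂ ∧
      c ≤ c₁ + c₂ := by
  induction h with
  | zero A => exact ⟨0, 0, .zero _, .zero _, by simp⟩
  | leaf A k hk =>
    by_cases hp : p k
    · exact ⟨w k, 0, .leaf _ k (by simp [hk, hp]), .zero _, by simp⟩
    · exact ⟨0, w k, .zero _, .leaf _ k (by simp [hk, hp]), by simp⟩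
  | node A s hs ι I B c hI hB hA hc ih =>
    have ih' : ∀ i, ∃ c₁ c₂, i ∈ I → TreeValue w ((B i).filter p) c₁ ∧
        TreeValue w ((B i).filter fun k => ¬ p k) c₂ ∧ c i ≤ c₁ + c₂ := by
      intro i
      by_cases hi : i ∈ I
      · obtain ⟨c₁, c₂, h⟩ := ih i hi
        exact ⟨c₁, c₂, fun _ => h⟩
      · exact ⟨0, 0, fun h => absurd h hi⟩
    choose c₁ c₂ h using ih'
    refine ⟨_, _, .node _ s hs ι I _ c₁ hI (hB.subset fun i _ => Finset.filter_subset p _)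
      (fun i hi => Finset.filter_subset_filter p (hA i hi)) fun i hi => (h i hi).1,
      .node _ s hs ι I _ c₂ hI (hB.subset fun i _ => Finset.filter_subset (fun k => ¬ p k) _)
      (fun i hi => Finset.filter_subset_filter _ (hA i hi)) fun i hi => (h i hi).2.1, ?_⟩
    rw [← mul_add, ← Finset.sum_add_distrib]
    exact mul_le_mul_of_nonneg_left (Finset.sum_le_sum fun i hi => (h i hi).2.2)
      (inv_nonneg.2 (schF_natCast_pos hs).le)

/-- A lower bound for the product of the `f(s)` along a branch with nodes `f(s) < 4 * x`, in
terms of the sum `l` of the `log₂ (4 * s)` along the branch. -/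
def branchBound (x l : ℝ) : ℝ := (1 + l / 14) * (1 + l / (50 * x))

lemma branchBound_zero (x : ℝ) : branchBound x 0 = 1 := by simp [branchBound]

lemma branchBound_mono {l l' : ℝ} (hx : 0 < x) (hl : 0 ≤ l) (h : l ≤ l') :
    branchBound x l ≤ branchBound x l' := by
  have hl' : 0 ≤ l' := hl.trans h
  unfold branchBound
  gcongr

lemma one_le_branchBound {l : ℝ} (hx : 0 < x) (hl : 0 ≤ l) : 1 ≤ branchBound x l := by
  rw [← branchBound_zero x]
  exact branchBound_mono hx le_rfl hl

lemma branchBound_add_le {l : ℝ} (hx : 1 ≤ x) (hl : 0 ≤ l) {s : ℕ} (hs : 2 ≤ s)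
    (hsx : schF s ≤ 4 * x) :
    branchBound x (l + Real.logb 2 (4 * s)) ≤ branchBound x l * schF s := by
  have hs' : (2 : ℝ) ≤ s := by exact_mod_cast hs
  have h32 := three_halves_le_schF hs'
  set u := Real.logb 2 (4 * s)
  set φ := schF s
  have hu0 : 0 ≤ u := Real.logb_nonneg (by norm_num) (by linarith)
  have hu : u ≤ φ + 2 := by
    have h4 : Real.logb 2 4 = 2 := by
      rw [show (4 : ℝ) = 2 ^ (2 : ℝ) by norm_num, Real.logb_rpow] <;> norm_num
    have : u = 2 + Real.logb 2 s := by
      simp only [u]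
      rw [Real.logb_mul (by norm_num) (by positivity), h4]
    have : Real.logb 2 s ≤ φ :=
      Real.logb_le_logb_of_le (by norm_num) (by linarith) (by linarith)
    linarith
  have hux : u / (50 * x) ≤ 14 / 75 := by
    rw [div_le_div_iff₀ (by positivity) (by norm_num)]
    nlinarith
  have hux0 : 0 ≤ u / (50 * x) := by positivity
  have hl0 : 0 ≤ l / (50 * x) := by positivity
  have h1 : 1 + (l + u) / 14 ≤ (1 + l / 14) * (1 + u / 14) := by
    have : 0 ≤ l / 14 * (u / 14) := by positivity
    nlinarith
  have h2 : 1 + (l + u) / (50 * x) ≤ (1 + l / (50 * x)) * (1 + u / (50 * x)) := by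
    rw [add_div]
    nlinarith [mul_nonneg hl0 hux0]
  have h3 : (1 + u / 14) * (1 + u / (50 * x)) ≤ φ := by
    have : (1 + u / 14) * (1 + u / (50 * x)) ≤ (1 + (φ + 2) / 14) * (1 + 14 / 75) := by
      gcongr
    linarith
  unfold branchBound
  calc (1 + (l + u) / 14) * (1 + (l + u) / (50 * x))
      ≤ ((1 + l / 14) * (1 + u / 14)) * ((1 + l / (50 * x)) * (1 + u / (50 * x))) := by gcongr
    _ = ((1 + l / 14) * (1 + l / (50 * x))) * ((1 + u / 14) * (1 + u / (50 * x))) := by ring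
    _ ≤ _ := by gcongr

/-- `c` is dominated by large tree values on a separated family of subsets of `A`, damped
according to lengths `l` that satisfy a Kraft inequality with constant `K`. -/
def Decomposes (w : ℕ → ℝ) (x : ℝ) (A : Finset ℕ) (K c : ℝ) : Prop :=
  ∃ (ι : Type) (J : Finset ι) (B : ι → Finset ℕ) (d l : ι → ℝ),
    Separated J B ∧ (∀ j ∈ J, B j ⊆ A ∧ 0 ≤ l j ∧ LargeTreeValue w (4 * x) (B j) (d j)) ∧
    ∑ j ∈ J, (2 : ℝ) ^ (-l j) ≤ K ∧ c ≤ ∑ j ∈ J, d j / branchBound x (l j)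

lemma Decomposes.of_large (h : LargeTreeValue w (4 * x) A c) : Decomposes w x A 1 c :=
  ⟨Unit, Finset.univ, fun _ => A, fun _ => c, fun _ => 0, fun i _ j _ hij => (hij rfl).elim,
    by simpa using h, by simp, by simp [branchBound_zero]⟩

lemma Decomposes.sum {ι : Type} {I : Finset ι} {B : ι → Finset ℕ} {d : ι → ℝ}
    (hB : Separated I B) (hA : ∀ i ∈ I, B i ⊆ A)
    (h : ∀ i ∈ I, Decomposes w x (B i) 1 (d i)) {K : ℝ} (hK : (I.card : ℝ) ≤ K) :
    Decomposes w x A K (∑ i ∈ I, d i) := by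
  have h' : ∀ i, ∃ (κ : Type) (J : Finset κ) (D : κ → Finset ℕ) (d' l : κ → ℝ), i ∈ I →
      Separated J D ∧
      (∀ j ∈ J, D j ⊆ B i ∧ 0 ≤ l j ∧ LargeTreeValue w (4 * x) (D j) (d' j)) ∧
      ∑ j ∈ J, (2 : ℝ) ^ (-l j) ≤ 1 ∧ d i ≤ ∑ j ∈ J, d' j / branchBound x (l j) := by
    intro i
    by_cases hi : i ∈ I
    · obtain ⟨κ, J, D, d', l, h⟩ := h i hi
      exact ⟨κ, J, D, d', l, fun _ => h⟩
    · exact ⟨Unit, ∅, fun _ => ∅, 0, 0, fun h => absurd h hi⟩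
  choose κ J D d' l h1 h2 h3 h4 using h'
  refine ⟨Σ i, κ i, I.sigma J, fun p => D p.1 p.2, fun p => d' p.1 p.2, fun p => l p.1 p.2,
    hB.sigma h1 fun i hi j hj => (h2 i hi j hj).1, ?_, ?_, ?_⟩
  · rintro ⟨i, j⟩ hp
    rw [Finset.mem_sigma] at hp
    obtain ⟨h5, h6⟩ := h2 i hp.1 j hp.2
    exact ⟨h5.trans (hA i hp.1), h6⟩
  · rw [Finset.sum_sigma]
    refine (Finset.sum_le_sum h3).trans ?_
    simpa using hK
  · rw [Finset.sum_sigma]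
    exact Finset.sum_le_sum h4

lemma Decomposes.inv_schF_mul (hw : ∀ k, 0 ≤ w k) (hx : 1 ≤ x) {s : ℕ} (hs : 2 ≤ s)
    (hsx : schF s ≤ 4 * x) (h : Decomposes w x A (4 * s) c) :
    Decomposes w x A 1 ((schF s)⁻¹ * c) := by
  obtain ⟨ι, J, B, d, l, hB, hJ, hl, hc⟩ := h
  have hs' : (2 : ℝ) ≤ s := by exact_mod_cast hs
  have hu0 : 0 ≤ Real.logb 2 (4 * s) := Real.logb_nonneg (by norm_num) (by linarith)
  have hf := schF_natCast_pos hs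
  refine ⟨ι, J, B, d, fun j => l j + Real.logb 2 (4 * s), hB,
    fun j hj => ⟨(hJ j hj).1, add_nonneg (hJ j hj).2.1 hu0, (hJ j hj).2.2⟩, ?_, ?_⟩
  · have : ∀ j, (2 : ℝ) ^ (-(l j + Real.logb 2 (4 * s))) = 2 ^ (-l j) / (4 * s) := by
      intro j
      rw [neg_add, Real.rpow_add (by norm_num), Real.rpow_neg (by norm_num) (Real.logb _ _),
        Real.rpow_logb (by norm_num) (by norm_num) (by positivity)]
      rfl
    simp only [this]
    rw [← Finset.sum_div]
    exact div_le_one_of_le₀ hl (by positivity)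
  · rw [inv_mul_le_iff₀ hf, Finset.mul_sum]
    refine hc.trans (Finset.sum_le_sum fun j hj => ?_)
    obtain ⟨-, hl0, hd⟩ := hJ j hj
    have hd0 := hd.treeValue.nonneg hw
    have hb1 := one_le_branchBound (x := x) (by linarith) hl0
    have hb2 := one_le_branchBound (x := x) (by linarith) (add_nonneg hl0 hu0)
    rw [mul_div_assoc', div_le_div_iff₀ (by linarith) (by linarith)]
    have := mul_le_mul_of_nonneg_left (branchBound_add_le hx hl0 hs hsx) hd0
    linarith

lemma TreeValue.decomposes (hw : ∀ k, 0 ≤ w k) (hx : 1 ≤ x) (h : TreeValue w A c) :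
    Decomposes w x A 1 c := by
  induction h with
  | zero A => exact .of_large (Or.inl rfl)
  | leaf A k hk => exact .of_large (Or.inr (Or.inl ⟨k, hk, rfl⟩))
  | node A s hs ι I B c hI hB hA hc ih =>
    rcases le_total (4 * x) (schF s) with hsx | hsx
    · exact .of_large (Or.inr (Or.inr ⟨s, hs, hsx, ι, I, B, c, hI, hB, hA, hc, rfl⟩))
    · exact .inv_schF_mul hw hx hs hsx (.sum hB hA ih (by exact_mod_cast hI))

end TreeValue

section DampedSum

variable {ι : Type*} {J : Finset ι} {d l : ι → ℝ} {x y N b : ℝ}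

/-- A dyadic summation: if the sums of `d` over `{l ≤ z}` grow at most linearly in `z`, then the
sum of the `d j / branchBound x (l j)` is controlled. -/
lemma sum_div_branchBound_le (hx : 1 ≤ x) (hy : 0 < y) (hN : 0 ≤ N) (hb : b ≤ 4 * x)
    (hd : ∀ j ∈ J, 0 ≤ d j) (hl : ∀ j ∈ J, 0 ≤ l j)
    (h : ∀ z, 0 ≤ z → ∑ j ∈ J with l j ≤ z, d j ≤ N * (b + 2 + z)) :
    ∑ j ∈ J, d j / branchBound x (l j) ≤ N * (b + 2 + y + 2800 * x / y) := by
  have hx0 : 0 < x := by linarith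
  have key : ∀ M : ℕ, ∑ j ∈ J with l j ≤ y * 2 ^ M, d j / branchBound x (l j) ≤
      N * (b + 2 + y + 2800 * x / y * (1 - (1 / 2) ^ M)) := by
    intro M
    induction M with
    | zero =>
      simp only [pow_zero, mul_one, sub_self, mul_zero, add_zero]
      refine le_trans (Finset.sum_le_sum fun j hj => ?_) (h y hy.le)
      rw [Finset.mem_filter] at hj
      exact div_le_self (hd j hj.1) (one_le_branchBound hx0 (hl j hj.1))
    | succ M ih =>
      set z := y * 2 ^ M with hz
      have hz0 : 0 < z := by positivity
      have hz2 : y * 2 ^ (M + 1) = 2 * z := by rw [hz]; ring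
      have hbz : 0 < branchBound x z := one_pos.trans_le (one_le_branchBound hx0 hz0.le)
      have hsplit : ∑ j ∈ J with l j ≤ 2 * z, d j / branchBound x (l j) ≤
          ∑ j ∈ J with l j ≤ z, d j / branchBound x (l j) +
            (∑ j ∈ J with l j ≤ 2 * z, d j) / branchBound x z := by
        rw [Finset.sum_div, Finset.sum_filter, Finset.sum_filter, Finset.sum_filter,
          ← Finset.sum_add_distrib]
        refine Finset.sum_le_sum fun j hj => ?_
        have h1 := one_le_branchBound hx0 (hl j hj)
        have h2 : 0 ≤ d j / branchBound x z := div_nonneg (hd j hj) hbz.le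
        by_cases h3 : l j ≤ z
        · rw [if_pos h3, if_pos (by linarith), if_pos (by linarith)]
          linarith
        · rw [if_neg h3, zero_add]
          split_ifs
          · exact div_le_div_of_nonneg_left (hd j hj) hbz
              (branchBound_mono hx0 hz0.le (not_le.1 h3).le)
          · exact le_rfl
      have hshell : (∑ j ∈ J with l j ≤ 2 * z, d j) / branchBound x z ≤ N * (1400 * x / z) := by
        rw [div_le_iff₀ hbz]
        refine (h (2 * z) (by positivity)).trans ?_
        rw [mul_assoc]
        refine mul_le_mul_of_nonneg_left ?_ hN
        have : 1400 * x / z * branchBound x z =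
            100 * x + 2 * z + 1400 * x / z + 28 := by
          unfold branchBound
          field_simp
          ring
        have : 0 < 1400 * x / z := by positivity
        linarith
      have hfin : 1400 * x / z = 2800 * x / y * ((1 / 2) ^ M - (1 / 2) ^ (M + 1)) := by
        rw [hz, pow_succ, one_div_pow]
        field_simp
        ring
      rw [hz2]
      calc _ ≤ _ := hsplit
        _ ≤ N * (b + 2 + y + 2800 * x / y * (1 - (1 / 2) ^ M)) + N * (1400 * x / z) :=
          add_le_add ih hshell
        _ = _ := by rw [hfin]; ring
  obtain ⟨M, hM⟩ : ∃ M : ℕ, ∀ j ∈ J, l j ≤ y * 2 ^ M := by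
    obtain ⟨M, hM⟩ := pow_unbounded_of_one_lt ((∑ j ∈ J, l j) / y) (one_lt_two (α := ℝ))
    refine ⟨M, fun j hj => (Finset.single_le_sum hl hj).trans ?_⟩
    rw [div_lt_iff₀ hy] at hM
    linarith
  have h1 := key M
  rw [Finset.filter_true_of_mem hM] at h1
  refine h1.trans (mul_le_mul_of_nonneg_left ?_ hN)
  have : 0 ≤ 2800 * x / y * (1 / 2) ^ M := by positivity
  linarith

end DampedSum

lemma schF_mul_rpow_le {s : ℝ} (hs : 0 ≤ s) {z : ℝ} (hz : 0 ≤ z) :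
    schF (4 * s * 2 ^ z) ≤ schF s + 2 + z := by
  have h4 : Real.logb 2 4 = 2 := by
    rw [show (4 : ℝ) = 2 ^ (2 : ℝ) by norm_num, Real.logb_rpow] <;> norm_num
  have hz1 : (1 : ℝ) ≤ 2 ^ z := Real.one_le_rpow (by norm_num) hz
  have h : schF s + 2 + z = Real.logb 2 ((s + 1) * 4 * 2 ^ z) := by
    rw [Real.logb_mul (by positivity) (by positivity), Real.logb_mul (by positivity) (by norm_num),
      h4, Real.logb_rpow (by norm_num) (by norm_num)]
    rfl
  rw [h]
  exact Real.logb_le_logb_of_le (by norm_num) (by positivity) (by nlinarith)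

lemma card_filter_le_of_sum_rpow_le {ι : Type*} {J : Finset ι} {l : ι → ℝ} {K z : ℝ}
    (h : ∑ j ∈ J, (2 : ℝ) ^ (-l j) ≤ K) :
    ((J.filter fun j => l j ≤ z).card : ℝ) ≤ K * 2 ^ z := by
  have h1 : ∑ j ∈ J with l j ≤ z, (2 : ℝ) ^ (-z) ≤ K := by
    refine le_trans (Finset.sum_le_sum fun j hj => ?_)
      (le_trans (Finset.sum_le_sum_of_subset_of_nonneg (Finset.filter_subset _ J)
        fun j _ _ => by positivity) h)
    exact Real.rpow_le_rpow_of_exponent_le (by norm_num)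
      (neg_le_neg (Finset.mem_filter.1 hj).2)
  rw [Finset.sum_const, nsmul_eq_mul, Real.rpow_neg (by norm_num)] at h1
  have : (0 : ℝ) < 2 ^ z := by positivity
  rwa [← div_eq_mul_inv, div_le_iff₀ this] at h1

/-- One step in the passage from large tree values to the norm. -/
lemma Decomposes.le_norm (hS : IsSchlumprecht S e) {a : ℕ →₀ ℝ} {x y Φ c : ℝ}
    (hx : 1 ≤ x) (hy : 0 < y) (hΦ : 0 ≤ Φ) {s : ℕ} (hs : 2 ≤ s) (hsx : schF s ≤ 4 * x)
    {A : Finset ℕ} (h : Decomposes (fun k => |a k|) x A (4 * s) c)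
    (hΦA : ∀ B ⊆ A, ∀ d, LargeTreeValue (fun k => |a k|) (4 * x) B d →
      d ≤ Φ * ‖embed e (restr a B)‖) :
    c ≤ Φ * ‖embed e (restr a A)‖ * (schF s + 2 + y + 2800 * x / y) := by
  obtain ⟨ι, J, B, d, l, hB, hJ, hl, hc⟩ := h
  refine hc.trans (sum_div_branchBound_le hx hy (by positivity) hsx
    (fun j hj => (hJ j hj).2.2.treeValue.nonneg fun k => abs_nonneg _)
    (fun j hj => (hJ j hj).2.1) fun z hz => ?_)
  have hs' : (2 : ℝ) ≤ s := by exact_mod_cast hs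
  have hz1 : (1 : ℝ) ≤ 2 ^ z := Real.one_le_rpow (by norm_num) hz
  calc ∑ j ∈ J with l j ≤ z, d j
      ≤ ∑ j ∈ J with l j ≤ z, Φ * ‖embed e (restr a (B j))‖ := Finset.sum_le_sum fun j hj => by
        obtain ⟨h1, -, h2⟩ := hJ j (Finset.mem_filter.1 hj).1
        exact hΦA _ h1 _ h2
    _ = Φ * ∑ j ∈ J with l j ≤ z, ‖embed e (restr a (B j))‖ := by rw [Finset.mul_sum]
    _ ≤ Φ * (schF (4 * s * 2 ^ z) * ‖embed e (restr a A)‖) := by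
        gcongr
        exact hS.sum_norm_restr_le_of_separated a (hB.mono (Finset.filter_subset _ J))
          (fun j hj => (hJ j (Finset.mem_filter.1 hj).1).1) (by nlinarith)
          (card_filter_le_of_sum_rpow_le hl)
    _ ≤ Φ * ((schF s + 2 + z) * ‖embed e (restr a A)‖) := by
        gcongr
        exact schF_mul_rpow_le (by positivity) hz
    _ = _ := by ring

lemma LargeTreeValue.le_exp_mul_norm (hS : IsSchlumprecht S e) (a : ℕ →₀ ℝ) (n p : ℕ)
    {A : Finset ℕ} (hA : A.card ≤ 4 ^ (p + n)) {c : ℝ}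
    (h : LargeTreeValue (fun k => |a k|) (4 ^ p) A c) :
    c ≤ Real.exp (5606 / 2 ^ p) * ‖embed e (restr a A)‖ := by
  have habs : ∀ k : ℕ, 0 ≤ |a k| := fun k => abs_nonneg _
  induction n generalizing p A c with
  | zero =>
    have h1 : 1 ≤ Real.exp (5606 / 2 ^ p) := Real.one_le_exp (by positivity)
    refine le_trans ?_ (le_mul_of_one_le_left (norm_nonneg _) h1)
    have hk : ∀ k ∈ A, |a k| ≤ ‖embed e (restr a A)‖ := fun k hk => by
      simpa [restr_apply, hk] using hS.abs_le_norm (restr a A) k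
    rcases h with rfl | ⟨k, hkA, rfl⟩ | ⟨s, hs, hsx, ι, I, B, d, hI, hB, hBA, hd, rfl⟩
    · positivity
    · exact hk k hkA
    · have h4 : (0 : ℝ) < 4 ^ p := by positivity
      rw [inv_mul_le_iff₀ (h4.trans_le hsx)]
      calc ∑ i ∈ I, d i ≤ ∑ i ∈ I, ∑ k ∈ B i, |a k| :=
            Finset.sum_le_sum fun i hi => (hd i hi).le_sum habs
        _ ≤ ∑ k ∈ A, |a k| := sum_sum_le_of_separated habs hB hBA
        _ ≤ ∑ k ∈ A, ‖embed e (restr a A)‖ := Finset.sum_le_sum hk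
        _ = A.card * ‖embed e (restr a A)‖ := by rw [Finset.sum_const, nsmul_eq_mul]
        _ ≤ schF s * ‖embed e (restr a A)‖ := by
          gcongr
          refine le_trans ?_ hsx
          exact_mod_cast hA
  | succ n ih =>
    have hΦA : ∀ B ⊆ A, ∀ d, LargeTreeValue (fun k => |a k|) (4 * 4 ^ p) B d →
        d ≤ Real.exp (5606 / 2 ^ (p + 1)) * ‖embed e (restr a B)‖ := by
      intro B hB d hd
      rw [← pow_succ'] at hd
      exact ih (p + 1)
        ((Finset.card_le_card hB).trans (by rwa [show p + 1 + n = p + (n + 1) by omega])) hd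
    have hexp : Real.exp (5606 / 2 ^ (p + 1)) ≤ Real.exp (5606 / 2 ^ p) := by
      gcongr
      · norm_num
      · omega
    rcases h with rfl | ⟨k, hkA, rfl⟩ | ⟨s, hs, hsx, ι, I, B, d, hI, hB, hBA, hd, rfl⟩
    · positivity
    · exact (hΦA A subset_rfl _ (Or.inr (Or.inl ⟨k, hkA, rfl⟩))).trans (by gcongr)
    · rcases le_total (4 * 4 ^ p) (schF s) with h4 | h4
      · exact (hΦA A subset_rfl _ (Or.inr (Or.inr
          ⟨s, hs, h4, ι, I, B, d, hI, hB, hBA, hd, rfl⟩))).trans (by gcongr)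
      · have hx : (1 : ℝ) ≤ 4 ^ p := one_le_pow₀ (by norm_num)
        have hdec := Decomposes.sum hB hBA (fun i hi => (hd i hi).decomposes habs hx)
          (K := 4 * s) (by exact_mod_cast hI)
        have h2 : (0 : ℝ) < 2 ^ p := by positivity
        have h1 := hdec.le_norm hS hx h2 (Real.exp_nonneg _) hs h4 hΦA
        have hf := schF_natCast_pos hs
        have h42 : (4 : ℝ) ^ p = 2 ^ p * 2 ^ p := by rw [← mul_pow]; norm_num
        rw [inv_mul_le_iff₀ hf]
        refine h1.trans ?_
        set v := ‖embed e (restr a A)‖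
        have hv : 0 ≤ v := norm_nonneg _
        set q : ℝ := 2 ^ p with hq
        have hq1 : 1 ≤ q := one_le_pow₀ (by norm_num)
        have h3 : schF s + 2 + q + 2800 * 4 ^ p / q ≤ schF s * (1 + 2803 / q) := by
          have h5 : 2800 * 4 ^ p / q = 2800 * q := by
            rw [h42]
            field_simp
          have h6 : q ≤ schF s / q := by
            rw [le_div_iff₀ h2, ← h42]
            exact hsx
          have h7 : schF s * (1 + 2803 / q) = schF s + 2803 * (schF s / q) := by ring
          rw [h5, h7]
          linarith
        have h8 : Real.exp (5606 / 2 ^ (p + 1)) * (1 + 2803 / q) ≤ Real.exp (5606 / q) := by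
          have h9 : 5606 / q = 5606 / 2 ^ (p + 1) + 2803 / q := by
            rw [pow_succ, ← hq]
            field_simp
            norm_num
          rw [h9, Real.exp_add]
          gcongr
          rw [add_comm]
          exact Real.add_one_le_exp _
        calc Real.exp (5606 / 2 ^ (p + 1)) * v * (schF s + 2 + q + 2800 * 4 ^ p / q)
            ≤ Real.exp (5606 / 2 ^ (p + 1)) * v * (schF s * (1 + 2803 / q)) := by gcongr
          _ = schF s * (Real.exp (5606 / 2 ^ (p + 1)) * (1 + 2803 / q) * v) := by ring
          _ ≤ _ := by gcongr

/-- Tree functionals are bounded on the Schlumprecht space. -/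
lemma TreeValue.le_exp_mul_norm (hS : IsSchlumprecht S e) (a : ℕ →₀ ℝ) {A : Finset ℕ} {c : ℝ}
    (h : TreeValue (fun k => |a k|) A c) :
    c ≤ Real.exp 5606 * ‖embed e a‖ := by
  have h1 := LargeTreeValue.le_exp_mul_norm hS a A.card 0 (A := A)
    (by simpa using (Nat.lt_pow_self (by norm_num : 1 < 4)).le) (by simpa using h.large)
  rw [pow_zero, div_one] at h1
  exact h1.trans (by gcongr; exact hS.norm_restr_le a A)

section TreeDominated

variable {w : ℕ → ℝ} {ε : ℕ → ℝ}

/-- `t` is dominated by twice a tree value on `K`, up to one coordinate and a weighted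
`ℓ₁`-error. -/
def TreeDominated (w ε : ℕ → ℝ) (K : Finset ℕ) (t : ℝ) : Prop :=
  ∃ K₀ ⊆ K, K₀.card ≤ 1 ∧ ∃ c, TreeValue w (K \ K₀) c ∧
    t ≤ ∑ k ∈ K₀, w k + ∑ k ∈ K, ε k * w k + 2 * c

lemma Separated.disjSum {ι κ : Type*} {I : Finset ι} {J : Finset κ} {B : ι → Finset ℕ}
    {D : κ → Finset ℕ} (hI : Separated I B) (hJ : Separated J D)
    (h : ∀ i ∈ I, ∀ j ∈ J, (∀ m ∈ B i, ∀ n ∈ D j, m < n) ∨ ∀ m ∈ B i, ∀ n ∈ D j, n < m) :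
    Separated (I.disjSum J) (Sum.elim B D) := by
  rintro (i | i) hi (j | j) hj hij
  · exact hI i (by simpa using hi) j (by simpa using hj) fun h => hij (by rw [h])
  · exact h i (by simpa using hi) j (by simpa using hj)
  · exact (h j (by simpa using hj) i (by simpa using hi)).symm.imp
      (fun h m hm n hn => h n hn m hm) fun h m hm n hn => h n hn m hm
  · exact hJ i (by simpa using hi) j (by simpa using hj) fun h => hij (by rw [h])

/-- A coordinate and a tree value on the complement are carried by three successive sets. -/
lemma TreeValue.exists_fin_three {K K₀ : Finset ℕ} (hK : K₀ ⊆ K) (h₀ : K₀.card ≤ 1) {c : ℝ}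
    (h : TreeValue w (K \ K₀) c) :
    ∃ (B : Fin 3 → Finset ℕ) (d : Fin 3 → ℝ), Separated Finset.univ B ∧ (∀ j, B j ⊆ K) ∧
      (∀ j, TreeValue w (B j) (d j)) ∧ ∑ k ∈ K₀, w k + c ≤ ∑ j, d j := by
  rcases Nat.le_one_iff_eq_zero_or_eq_one.1 h₀ with h₀ | h₀
  · rw [Finset.card_eq_zero] at h₀
    subst h₀
    rw [Finset.sdiff_empty] at h
    refine ⟨![K, ∅, ∅], ![c, 0, 0], ?_, ?_, ?_, by simp [Fin.sum_univ_three]⟩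
    · intro i _ j _ hij
      fin_cases i <;> fin_cases j <;> simp at hij ⊢
    · intro j
      fin_cases j <;> simp
    · intro j
      fin_cases j
      · exact h
      · exact .zero _
      · exact .zero _
  · obtain ⟨κ, rfl⟩ := Finset.card_eq_one.1 h₀
    obtain ⟨c₁, c₂, h1, h2, h3⟩ := h.exists_filter fun k => k < κ
    refine ⟨![{κ}, (K \ {κ}).filter fun k => k < κ, (K \ {κ}).filter fun k => ¬ k < κ],
      ![w κ, c₁, c₂], ?_, ?_, ?_, by simp [Fin.sum_univ_three]; linarith⟩
    · intro i _ j _ hij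
      fin_cases i <;> fin_cases j <;> simp at hij ⊢ <;> grind
    · have h4 : K \ {κ} ⊆ K := Finset.sdiff_subset
      intro j
      fin_cases j
      · exact hK
      · exact (Finset.filter_subset _ _).trans h4
      · exact (Finset.filter_subset _ _).trans h4
    · intro j
      fin_cases j
      · exact .leaf _ κ (by simp)
      · exact h1
      · exact h2

/-- Gluing of dominated quantities at a node of weight `1 / f(s)`: the sets `K' i` correspond to
coordinates seen by one piece only, and `P` to the coordinates split between several pieces. -/
lemma TreeDominated.node (hw : ∀ k, 0 ≤ w k) (hε : ∀ k, 0 ≤ ε k) {s : ℕ} (hs : 2 ≤ s)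
    {K P P₃ : Finset ℕ} {K' : Fin s → Finset ℕ} {t : Fin s → ℝ} {b : ℕ → ℝ}
    (hK' : ∀ i, K' i ⊆ K) (hPK : P ⊆ K) (hdisj : ∀ i, Disjoint (K' i) P)
    (hsep : Separated Finset.univ K')
    (hcross : ∀ i, ∀ p ∈ P, (∀ k ∈ K' i, k < p) ∨ ∀ k ∈ K' i, p < k) (hPs : P.card ≤ s)
    (ht : ∀ i, TreeDominated w ε (K' i) (t i)) (hP₃ : P₃ ⊆ P) (hP₃' : P₃.card ≤ 1)
    (hb₃ : ∀ p ∈ P₃, b p ≤ schF s)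
    (hb : ∀ p ∈ P, p ∉ P₃ → b p ≤ 2 ∨ b p ≤ ε p * schF s) :
    TreeDominated w ε K ((schF s)⁻¹ * (∑ i, t i + ∑ p ∈ P, w p * b p)) := by
  choose K₀ hK₀ hcard c hc htc using ht
  choose B d hBsep hBK hBd hd using fun i => (hc i).exists_fin_three (hK₀ i) (hcard i)
  have hf := schF_natCast_pos hs
  set P₁ := (P \ P₃).filter fun p => b p ≤ 2 with hP₁
  have hP₁P : P₁ ⊆ P := (Finset.filter_subset _ _).trans Finset.sdiff_subset
  have hK'P₃ : ∀ i, K' i ⊆ K \ P₃ := fun i =>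
    Finset.subset_sdiff.2 ⟨hK' i, (hdisj i).mono_right hP₃⟩
  have hP₁P₃ : P₁ ⊆ K \ P₃ :=
    (Finset.filter_subset _ _).trans (Finset.sdiff_subset_sdiff hPK subset_rfl)
  have hsigma : Separated (Finset.univ.sigma fun _ : Fin s => (Finset.univ : Finset (Fin 3)))
      fun p => B p.1 p.2 := hsep.sigma (fun i _ => hBsep i) fun i _ j _ => hBK i j
  have hnode : TreeValue w (K \ P₃) ((schF s)⁻¹ *
      ∑ q ∈ (Finset.univ.sigma fun _ : Fin s => (Finset.univ : Finset (Fin 3))).disjSum P₁,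
        Sum.elim (fun p => d p.1 p.2) w q) := by
    refine .node _ s hs _ _ (Sum.elim (fun p => B p.1 p.2) fun k => {k}) _ ?_
      (hsigma.disjSum ?_ ?_) ?_ ?_
    · have := Finset.card_le_card hP₁P
      rw [Finset.card_disjSum, Finset.card_sigma]
      simp
      omega
    · intro i _ j _ hij
      simpa using lt_or_gt_of_ne hij
    · intro p _ k hk
      refine (hcross p.1 k (hP₁P hk)).imp (fun h m hm n hn => ?_) fun h m hm n hn => ?_
      · rw [Finset.mem_singleton.1 hn]
        exact h m (hBK _ _ hm)
      · rw [Finset.mem_singleton.1 hn]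
        exact h m (hBK _ _ hm)
    · rintro (p | k) hq
      · exact (hBK _ _).trans (hK'P₃ _)
      · exact Finset.singleton_subset_iff.2 (hP₁P₃ (by simpa using hq))
    · rintro (p | k) hq
      · exact hBd _ _
      · exact .leaf _ k (by simp)
  refine ⟨P₃, hP₃.trans hPK, hP₃', _, hnode, ?_⟩
  rw [Finset.sum_disjSum, Finset.sum_sigma]
  simp only [Sum.elim_inl, Sum.elim_inr]
  have hPb : ∑ p ∈ P, w p * b p ≤
      2 * ∑ p ∈ P₁, w p + schF s * ∑ p ∈ P, ε p * w p + schF s * ∑ p ∈ P₃, w p := by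
    rw [Finset.mul_sum, Finset.mul_sum, Finset.mul_sum, ← Finset.inter_eq_right.2 hP₁P,
      ← Finset.inter_eq_right.2 hP₃, ← Finset.sum_ite_mem, ← Finset.sum_ite_mem,
      ← Finset.sum_add_distrib, ← Finset.sum_add_distrib]
    refine Finset.sum_le_sum fun p hp => ?_
    have h1 : 0 ≤ schF s * (ε p * w p) := mul_nonneg hf.le (mul_nonneg (hε p) (hw p))
    have h2 := hw p
    by_cases h3 : p ∈ P₃
    · have h4 : p ∉ P₁ := by simp [hP₁, h3]
      simp only [h3, h4, if_true, if_false]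
      nlinarith [hb₃ p h3]
    · simp only [h3, if_false]
      by_cases h4 : b p ≤ 2
      · have h5 : p ∈ P₁ := by simp [hP₁, h3, h4, hp]
        simp only [h5, if_true]
        nlinarith
      · have h5 : p ∉ P₁ := by simp [hP₁, h4]
        simp only [h5, if_false]
        nlinarith [(hb p hp h3).resolve_left h4]
  have hε1 : ∑ i, ∑ k ∈ K' i, ε k * w k + ∑ p ∈ P, ε p * w p ≤ ∑ k ∈ K, ε k * w k := by
    rw [← Finset.sum_biUnion fun i hi j hj hij => hsep.disjoint hi hj hij, ← Finset.sum_union]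
    · refine Finset.sum_le_sum_of_subset_of_nonneg ?_ fun k _ _ => mul_nonneg (hε k) (hw k)
      exact Finset.union_subset (Finset.biUnion_subset.2 fun i _ => hK' i) hPK
    · exact (Finset.disjoint_biUnion_left _ _ _).2 fun i _ => hdisj i
  have hsum : ∑ i, t i ≤ ∑ i, ∑ k ∈ K' i, ε k * w k + 2 * ∑ i, ∑ j, d i j := by
    rw [Finset.mul_sum, ← Finset.sum_add_distrib]
    refine Finset.sum_le_sum fun i _ => ?_
    have := Finset.sum_nonneg (s := K₀ i) fun k _ => hw k
    linarith [htc i, hd i]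
  have hf1 : 1 ≤ schF s := one_le_schF (by exact_mod_cast (by omega : 1 ≤ s))
  have hε0 : 0 ≤ ∑ i, ∑ k ∈ K' i, ε k * w k :=
    Finset.sum_nonneg fun i _ => Finset.sum_nonneg fun k _ => mul_nonneg (hε k) (hw k)
  rw [inv_mul_le_iff₀ hf]
  have h6 : schF s * (2 * ((schF s)⁻¹ * (∑ i, ∑ j, d i j + ∑ p ∈ P₁, w p))) =
      2 * (∑ i, ∑ j, d i j + ∑ p ∈ P₁, w p) := by
    field_simp
  rw [mul_add, h6]
  nlinarith [mul_le_mul_of_nonneg_left hε1 hf.le]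

end TreeDominated

lemma TreeDominated.of_le {w ε : ℕ → ℝ} {K : Finset ℕ} {t t' : ℝ} (h : TreeDominated w ε K t)
    (ht : t' ≤ t) : TreeDominated w ε K t' := by
  obtain ⟨K₀, h1, h2, c, h3, h4⟩ := h
  exact ⟨K₀, h1, h2, c, h3, ht.trans h4⟩

section Blocks

variable {y : ℕ → ℕ →₀ ℝ}

lemma IsNormalizedBlockBasis.lt (hy : IsNormalizedBlockBasis e y) {k k' : ℕ} (h : k < k')
    {m n : ℕ} (hm : m ∈ (y k).support) (hn : n ∈ (y k').support) : m < n := by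
  induction k', h using Nat.le_induction generalizing n with
  | base => exact hy.2.1 k m hm n hn
  | succ k' hk ih =>
    obtain ⟨p, hp⟩ := Finsupp.support_nonempty_iff.2 (hy.1 k')
    exact (ih hp).trans (hy.2.1 k' p hp n hn)

lemma IsNormalizedBlockBasis.eq_of_mem (hy : IsNormalizedBlockBasis e y) {k k' m : ℕ}
    (hm : m ∈ (y k).support) (hm' : m ∈ (y k').support) : k = k' := by
  by_contra h
  rcases lt_or_gt_of_ne h with h | h
  · exact lt_irrefl _ (hy.lt h hm hm')
  · exact lt_irrefl _ (hy.lt h hm' hm)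

/-- The vector `Σ aₖ yₖ`. -/
def blockSum (y : ℕ → ℕ →₀ ℝ) (a : ℕ →₀ ℝ) : ℕ →₀ ℝ := a.sum fun k c => c • y k

lemma embed_blockSum (a : ℕ →₀ ℝ) :
    embed e (blockSum y a) = a.sum fun k c => c • embed e (y k) := by
  simp only [embed_eq, blockSum, Finsupp.sum, map_sum, map_smul]

lemma blockSum_apply (a : ℕ →₀ ℝ) (i : ℕ) :
    blockSum y a i = ∑ k ∈ a.support, a k * y k i := by
  simp [blockSum, Finsupp.sum, Finsupp.finsetSum_apply]

lemma exists_mem_of_blockSum_ne_zero {a : ℕ →₀ ℝ} {i : ℕ} (h : blockSum y a i ≠ 0) :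
    ∃ k ∈ a.support, i ∈ (y k).support := by
  rw [blockSum_apply] at h
  obtain ⟨k, hk, hne⟩ := Finset.exists_ne_zero_of_sum_ne_zero h
  exact ⟨k, hk, Finsupp.mem_support_iff.2 (right_ne_zero_of_mul hne)⟩

lemma IsNormalizedBlockBasis.blockSum_apply_of_mem (hy : IsNormalizedBlockBasis e y)
    (a : ℕ →₀ ℝ) {k i : ℕ} (h : i ∈ (y k).support) : blockSum y a i = a k * y k i := by
  rw [blockSum_apply]
  refine Finset.sum_eq_single k (fun k' _ hk' => ?_) fun hk => ?_
  · rw [mul_eq_zero]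
    right
    by_contra h0
    exact hk' (hy.eq_of_mem (Finsupp.mem_support_iff.2 h0) h)
  · rw [Finsupp.notMem_support_iff.1 hk, zero_mul]

lemma IsNormalizedBlockBasis.restr_blockSum (hy : IsNormalizedBlockBasis e y) (a : ℕ →₀ ℝ)
    (P D : Finset ℕ) :
    restr (blockSum y a) D = restr (blockSum y a) (D \ P.biUnion fun k => (y k).support) +
      ∑ k ∈ P, a k • restr (y k) D := by
  ext i
  simp only [Finsupp.add_apply, Finsupp.finsetSum_apply, Finsupp.smul_apply, smul_eq_mul,
    restr_apply]
  by_cases hD : i ∈ D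
  · simp only [hD, if_true]
    by_cases hU : i ∈ P.biUnion fun k => (y k).support
    · rw [if_neg (by simp [hU]), zero_add]
      obtain ⟨k, hk, hik⟩ := Finset.mem_biUnion.1 hU
      rw [hy.blockSum_apply_of_mem a hik, Finset.sum_eq_single_of_mem k hk]
      intro k' _ hk'
      rw [mul_eq_zero]
      right
      by_contra h0
      exact hk' (hy.eq_of_mem (Finsupp.mem_support_iff.2 h0) hik)
    · rw [if_pos (Finset.mem_sdiff.2 ⟨hD, hU⟩), Finset.sum_eq_zero, add_zero]
      intro k hk
      rw [mul_eq_zero]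
      right
      by_contra h0
      exact hU (Finset.mem_biUnion.2 ⟨k, hk, Finsupp.mem_support_iff.2 h0⟩)
  · simp [hD]

lemma IsNormalizedBlockBasis.norm_restr_blockSum_le (hy : IsNormalizedBlockBasis e y)
    (a : ℕ →₀ ℝ) (P D : Finset ℕ) :
    ‖embed e (restr (blockSum y a) D)‖ ≤
      ‖embed e (restr (blockSum y a) (D \ P.biUnion fun k => (y k).support))‖ +
        ∑ k ∈ P, |a k| * ‖embed e (restr (y k) D)‖ := by
  conv_lhs => rw [hy.restr_blockSum a P D, embed_eq, map_add, map_sum]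
  refine (norm_add_le _ _).trans (add_le_add le_rfl ((norm_sum_le _ _).trans_eq ?_))
  refine Finset.sum_congr rfl fun k _ => ?_
  rw [map_smul, norm_smul, Real.norm_eq_abs]
  rfl

/-- The indices of the blocks in the expansion of `Σ aₖ yₖ` whose support meets `E`. -/
def met (y : ℕ → ℕ →₀ ℝ) (a : ℕ →₀ ℝ) (E : Finset ℕ) : Finset ℕ :=
  a.support.filter fun k => ¬ Disjoint (y k).support E

lemma met_mono (a : ℕ →₀ ℝ) {E F : Finset ℕ} (h : E ⊆ F) : met y a E ⊆ met y a F :=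
  Finset.monotone_filter_right _ fun _ _ hk hF => hk (hF.mono_right h)

lemma IsNormalizedBlockBasis.le_of_succ (hy : IsNormalizedBlockBasis e y) {s : ℕ}
    {D : Fin s → Finset ℕ} (hD : Succ D) {i j : Fin s} (hij : i < j) {k k' : ℕ}
    (hk : ¬ Disjoint (y k).support (D i)) (hk' : ¬ Disjoint (y k').support (D j)) :
    k ≤ k' := by
  obtain ⟨m, hm, hmD⟩ := Finset.not_disjoint_iff.1 hk
  obtain ⟨n, hn, hnD⟩ := Finset.not_disjoint_iff.1 hk'
  by_contra h
  exact lt_asymm (hD i j hij m hmD n hnD) (hy.lt (not_le.1 h) hn hm)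

/-- The indices of the blocks whose support meets at least two of the sets `D i`. -/
def splitBlocks (y : ℕ → ℕ →₀ ℝ) (a : ℕ →₀ ℝ) {s : ℕ} (D : Fin s → Finset ℕ) : Finset ℕ :=
  a.support.filter fun k =>
    ∃ i j, i < j ∧ ¬ Disjoint (y k).support (D i) ∧ ¬ Disjoint (y k).support (D j)

lemma IsNormalizedBlockBasis.card_splitBlocks_le (hy : IsNormalizedBlockBasis e y)
    (a : ℕ →₀ ℝ) {s : ℕ} {D : Fin s → Finset ℕ} (hD : Succ D) :
    (splitBlocks y a D).card ≤ s := by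
  have h : ∀ k ∈ splitBlocks y a D, ∃ i j, i < j ∧ ¬ Disjoint (y k).support (D i) ∧
      ¬ Disjoint (y k).support (D j) := fun k hk => (Finset.mem_filter.1 hk).2
  rcases s.eq_zero_or_pos with rfl | hs
  · rw [Nat.le_zero, Finset.card_eq_zero]
    exact Finset.eq_empty_of_forall_notMem fun k hk => (h k hk).choose.elim0
  · have : NeZero s := ⟨hs.ne'⟩
    choose! i j hij hi hj using h
    refine (Finset.card_le_card_of_injOn (t := Finset.univ) i (by simp) ?_).trans_eq
      (by simp)
    intro k hk k' hk' hkk'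
    refine le_antisymm ?_ ?_
    · exact hy.le_of_succ hD (hkk' ▸ hij k' hk') (hi k hk) (hj k' hk')
    · exact hy.le_of_succ hD (hkk'.symm ▸ hij k hk) (hi k' hk') (hj k hk)

end Blocks

/-- The conditions on the blocks `y k`: they are nearly isometric to unit vectors when tested
against few sets, and their supports are small compared with `f(r k / 3)`. -/
structure IsFastBlockSequence (e : ℕ → S) (ε : ℕ → ℝ) (r : ℕ → ℕ) (y : ℕ → ℕ →₀ ℝ) : Prop where
  blockBasis : IsNormalizedBlockBasis e y
  monotone : Monotone r
  sum_le : ∀ k, 1 ≤ k → ∀ ρ : ℕ, ρ ≤ r (k - 1) → ∀ E : Fin ρ → Finset ℕ, Succ E →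
    ∑ i, ‖embed e (restr (y k) (E i))‖ ≤ 1 + ε k
  card_le : ∀ k, ((y k).support.card : ℝ) ≤ ε k * schF ((r k : ℝ) / 3)

section Upper

variable {ε : ℕ → ℝ} {r : ℕ → ℕ} {y : ℕ → ℕ →₀ ℝ}

lemma IsFastBlockSequence.treeDominated_node (hS : IsSchlumprecht S e)
    (h : IsFastBlockSequence e ε r y) (hε : ∀ k, 0 ≤ ε k) (hε' : ∀ k, ε k ≤ 1) (a : ℕ →₀ ℝ)
    {s : ℕ} (hs : 2 ≤ s) {D : Fin s → Finset ℕ} (hD : Succ D) {E : Finset ℕ}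
    (hDE : ∀ i, D i ⊆ E) {t : Fin s → ℝ}
    (ht : ∀ i, TreeDominated (fun k => |a k|) ε
      (met y a (D i \ (splitBlocks y a D).biUnion fun k => (y k).support)) (t i)) :
    TreeDominated (fun k => |a k|) ε (met y a E) ((schF s)⁻¹ * (∑ i, t i +
      ∑ p ∈ splitBlocks y a D, |a p| * ∑ i, ‖embed e (restr (y p) (D i))‖)) := by
  set P := splitBlocks y a D with hP
  have hy := h.blockBasis
  have hmemP : ∀ p ∈ P, ∃ i j, i < j ∧ ¬ Disjoint (y p).support (D i) ∧
      ¬ Disjoint (y p).support (D j) := fun p hp => (Finset.mem_filter.1 hp).2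
  have hmet : ∀ i k, k ∈ met y a (D i \ P.biUnion fun k => (y k).support) →
      k ∈ a.support ∧ ¬ Disjoint (y k).support (D i) ∧ k ∉ P := by
    intro i k hk
    obtain ⟨h1, h2⟩ := Finset.mem_filter.1 hk
    refine ⟨h1, fun h3 => h2 (h3.mono_right Finset.sdiff_subset), fun h3 => h2 ?_⟩
    exact Finset.disjoint_sdiff.mono_left
      (Finset.subset_biUnion_of_mem (fun k => (y k).support) h3)
  have hlt : ∀ {i j k k'}, i < j → k ∈ met y a (D i \ P.biUnion fun k => (y k).support) →
      ¬ Disjoint (y k').support (D j) → k < k' := by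
    intro i j k k' hij hk hk'
    obtain ⟨h1, h2, h3⟩ := hmet i k hk
    refine (hy.le_of_succ hD hij h2 hk').lt_of_ne ?_
    rintro rfl
    exact h3 (Finset.mem_filter.2 ⟨h1, i, j, hij, h2, hk'⟩)
  have hgt : ∀ {i j k k'}, i < j → ¬ Disjoint (y k').support (D i) →
      k ∈ met y a (D j \ P.biUnion fun k => (y k).support) → k' < k := by
    intro i j k k' hij hk' hk
    obtain ⟨h1, h2, h3⟩ := hmet j k hk
    refine (hy.le_of_succ hD hij hk' h2).lt_of_ne ?_
    rintro rfl
    exact h3 (Finset.mem_filter.2 ⟨h1, i, j, hij, hk', h2⟩)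
  refine TreeDominated.node (P₃ := P.filter fun p => ¬ (1 ≤ p ∧ s ≤ r (p - 1)) ∧ s < r p)
    (fun k => abs_nonneg _) hε hs
    (fun i => met_mono a (Finset.sdiff_subset.trans (hDE i))) ?_ ?_ ?_ ?_
    (hy.card_splitBlocks_le a hD) ht (Finset.filter_subset _ _) ?_ ?_ ?_
  · intro p hp
    obtain ⟨i, j, -, h1, -⟩ := hmemP p hp
    exact Finset.mem_filter.2 ⟨(Finset.mem_filter.1 hp).1, fun h2 => h1 (h2.mono_right (hDE i))⟩
  · exact fun i => Finset.disjoint_left.2 fun k hk => (hmet i k hk).2.2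
  · intro i _ j _ hij
    rcases lt_or_gt_of_ne hij with hij | hij
    · exact Or.inl fun m hm n hn => hlt hij hm (hmet j n hn).2.1
    · exact Or.inr fun m hm n hn => hlt hij hn (hmet i m hm).2.1
  · intro i p hp
    obtain ⟨j, j', hjj', h1, h2⟩ := hmemP p hp
    rcases lt_or_ge i j' with hi | hi
    · exact Or.inl fun k hk => hlt hi hk h2
    · exact Or.inr fun k hk => hgt (hjj'.trans_le hi) h1 hk
  · rw [Finset.card_le_one]
    have : ∀ p q, p < q → s < r p → ¬ (1 ≤ q ∧ s ≤ r (q - 1)) → False := by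
      intro p q hpq h1 h2
      exact h2 ⟨by omega, h1.le.trans (h.monotone (by omega))⟩
    intro p hp q hq
    rw [Finset.mem_filter] at hp hq
    by_contra hne
    rcases lt_or_gt_of_ne hne with hpq | hpq
    · exact this p q hpq hp.2.2 hq.2.1
    · exact this q p hpq hq.2.2 hp.2.1
  · intro p _
    have := hS.sum_norm_restr_le (y p) hs hD
    rwa [hy.2.2 p, inv_mul_le_iff₀ (schF_natCast_pos hs), mul_one] at this
  · intro p hp hp3
    rw [Finset.mem_filter, not_and, not_and_or, not_not] at hp3
    rcases hp3 hp with ⟨h1, h2⟩ | h1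
    · exact Or.inl ((h.sum_le p h1 s h2 D hD).trans (by linarith [hε' p]))
    · right
      refine (hS.sum_norm_restr_le_card (y p) (hy.2.2 p).le hD).trans ((h.card_le p).trans ?_)
      refine mul_le_mul_of_nonneg_left (schF_le_schF (by positivity) ?_) (hε p)
      have h2 : (r p : ℝ) ≤ s := by exact_mod_cast not_lt.1 h1
      have h3 : (0 : ℝ) ≤ r p := Nat.cast_nonneg _
      linarith

lemma IsFastBlockSequence.treeDominated (hS : IsSchlumprecht S e)
    (h : IsFastBlockSequence e ε r y) (hε : ∀ k, 0 ≤ ε k) (hε' : ∀ k, ε k ≤ 1) (a : ℕ →₀ ℝ)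
    (E : Finset ℕ) {δ : ℝ} (hδ : 0 < δ) :
    TreeDominated (fun k => |a k|) ε (met y a E)
      (‖embed e (restr (blockSum y a) E)‖ - δ) := by
  have hy := h.blockBasis
  induction hn : ((blockSum y a).support ∩ E).card using Nat.strong_induction_on
    generalizing E δ with
  | _ n ih =>
  subst hn
  have herr : ∀ K : Finset ℕ, 0 ≤ ∑ k ∈ K, ε k * |a k| := fun K =>
    Finset.sum_nonneg fun k _ => mul_nonneg (hε k) (abs_nonneg _)
  rcases hS.norm_approx (restr (blockSum y a) E) (half_pos hδ) with
    ⟨i, hi⟩ | ⟨s, hs, F, hF, hsupp, hle⟩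
  · rw [restr_apply] at hi
    by_cases hiE : i ∈ E ∧ blockSum y a i ≠ 0
    · rw [if_pos hiE.1] at hi
      obtain ⟨k, hk, hik⟩ := exists_mem_of_blockSum_ne_zero hiE.2
      refine ⟨{k}, ?_, by simp, 0, .zero _, ?_⟩
      · exact Finset.singleton_subset_iff.2
          (Finset.mem_filter.2 ⟨hk, Finset.not_disjoint_iff.2 ⟨i, hik, hiE.1⟩⟩)
      · rw [hy.blockSum_apply_of_mem a hik, abs_mul] at hi
        have h1 : |y k i| ≤ 1 := (hS.abs_le_norm (y k) i).trans (hy.2.2 k).le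
        have h2 := mul_le_of_le_one_right (abs_nonneg (a k)) h1
        rw [Finset.sum_singleton]
        linarith [herr (met y a E)]
    · refine ⟨∅, by simp, by simp, 0, .zero _, ?_⟩
      have h0 : (if i ∈ E then blockSum y a i else 0) = 0 := by
        split_ifs with h1
        · by_contra h2
          exact hiE ⟨h1, h2⟩
        · rfl
      rw [h0, abs_zero] at hi
      rw [Finset.sum_empty]
      linarith [herr (met y a E)]
  · have hD : Succ fun i => F i ∩ E := hF.inter E
    set D : Fin s → Finset ℕ := fun i => F i ∩ E with hDdef
    have hDE : ∀ i, D i ⊆ E := fun i => Finset.inter_subset_right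
    set U := (splitBlocks y a D).biUnion fun k => (y k).support with hU
    have hf := schF_natCast_pos hs
    have hs0 : (0 : ℝ) < s := by exact_mod_cast (by omega : 0 < s)
    have hf1 : 1 ≤ schF s := one_le_schF (by exact_mod_cast (by omega : 1 ≤ s))
    have hcard : ∀ i, ((blockSum y a).support ∩ (D i \ U)).card <
        ((blockSum y a).support ∩ E).card := by
      intro i
      refine Finset.card_lt_card ((Finset.ssubset_iff_of_subset ?_).2 ?_)
      · exact Finset.inter_subset_inter subset_rfl (Finset.sdiff_subset.trans (hDE i))
      · obtain ⟨m, hm, hmF⟩ := Finset.not_subset.1 (hsupp i)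
        rw [support_restr] at hm
        exact ⟨m, hm, fun h1 => hmF
          (Finset.mem_inter.1 (Finset.mem_sdiff.1 (Finset.mem_inter.1 h1).2).1).1⟩
    have hdom := h.treeDominated_node hS hε hε' a hs hD hDE fun i =>
      ih _ (hcard i) (D i \ U) (δ := δ / (2 * s)) (by positivity) rfl
    refine hdom.of_le ?_
    have hsum : ∑ i, ‖embed e (restr (restr (blockSum y a) E) (F i))‖ ≤
        ∑ i, ‖embed e (restr (blockSum y a) (D i \ U))‖ +
          ∑ p ∈ splitBlocks y a D, |a p| * ∑ i, ‖embed e (restr (y p) (D i))‖ := by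
      simp only [Finset.mul_sum]
      rw [Finset.sum_comm, ← Finset.sum_add_distrib]
      refine Finset.sum_le_sum fun i _ => ?_
      rw [restr_restr]
      exact hy.norm_restr_blockSum_le a (splitBlocks y a D) (D i)
    have hδs : ∑ _i : Fin s, δ / (2 * s) = δ / 2 := by
      rw [Finset.sum_const, Finset.card_univ, Fintype.card_fin, nsmul_eq_mul]
      field_simp
    rw [Finset.sum_sub_distrib, hδs]
    have h1 := mul_le_mul_of_nonneg_left hsum (inv_nonneg.2 hf.le)
    have h2 : (schF s)⁻¹ * (δ / 2) ≤ δ / 2 :=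
      mul_le_of_le_one_left (by positivity) (inv_le_one_of_one_le₀ hf1)
    rw [sub_add_eq_add_sub, mul_sub]
    linarith

lemma IsFastBlockSequence.norm_blockSum_le (hS : IsSchlumprecht S e)
    (h : IsFastBlockSequence e ε r y) (hε : ∀ k, 0 < ε k) (hεsum : Summable ε)
    (hεle : ∑' k, ε k ≤ 1) (a : ℕ →₀ ℝ) :
    ‖embed e (blockSum y a)‖ ≤ (2 + 2 * Real.exp 5606) * ‖embed e a‖ := by
  have hε' : ∀ k, ε k ≤ 1 := fun k =>
    (hεsum.le_tsum k fun j _ => (hε j).le).trans hεle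
  refine le_of_forall_pos_le_add fun δ hδ => ?_
  obtain ⟨K₀, -, hcard, c, hc, hle⟩ := h.treeDominated hS (fun k => (hε k).le) hε' a
    (blockSum y a).support hδ
  rw [restr_eq_self subset_rfl] at hle
  have h1 : ∑ k ∈ K₀, |a k| ≤ ‖embed e a‖ := by
    refine (Finset.sum_le_card_nsmul _ _ _ fun k _ => hS.abs_le_norm a k).trans ?_
    rw [nsmul_eq_mul]
    exact mul_le_of_le_one_left (norm_nonneg _) (by exact_mod_cast hcard)
  have h2 : ∑ k ∈ met y a (blockSum y a).support, ε k * |a k| ≤ ‖embed e a‖ := by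
    calc ∑ k ∈ met y a (blockSum y a).support, ε k * |a k|
        ≤ ∑ k ∈ met y a (blockSum y a).support, ε k * ‖embed e a‖ :=
          Finset.sum_le_sum fun k _ =>
            mul_le_mul_of_nonneg_left (hS.abs_le_norm a k) (hε k).le
      _ = (∑ k ∈ met y a (blockSum y a).support, ε k) * ‖embed e a‖ := by
          rw [Finset.sum_mul]
      _ ≤ 1 * ‖embed e a‖ := by
          gcongr
          exact (hεsum.sum_le_tsum _ fun k _ => (hε k).le).trans hεle
      _ = _ := one_mul _
  linarith [hc.le_exp_mul_norm hS a]

end Upper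

/-- A normalized block basis dominates the unit vector basis. -/
lemma IsNormalizedBlockBasis.norm_le_norm_blockSum (hS : IsSchlumprecht S e)
    {y : ℕ → ℕ →₀ ℝ} (hy : IsNormalizedBlockBasis e y) (a : ℕ →₀ ℝ) :
    ‖embed e a‖ ≤ ‖embed e (blockSum y a)‖ := by
  suffices h : ∀ A : Finset ℕ, ‖embed e (restr a A)‖ ≤
      ‖embed e (restr (blockSum y a) (A.biUnion fun k => (y k).support))‖ by
    have := (h a.support).trans (hS.norm_restr_le _ _)
    rwa [restr_eq_self subset_rfl] at this
  intro A
  induction hn : (a.support ∩ A).card using Nat.strong_induction_on generalizing A with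
  | _ n ih =>
  subst hn
  refine le_of_forall_pos_le_add fun δ hδ => ?_
  rcases hS.norm_approx (restr a A) hδ with ⟨k, hk⟩ | ⟨s, hs, F, hF, hsupp, hle⟩
  · refine hk.trans (add_le_add_left ?_ _)
    rw [restr_apply]
    split_ifs with hkA
    · have h1 : restr (blockSum y a) (y k).support = a k • y k := by
        ext i
        rw [restr_apply, Finsupp.smul_apply, smul_eq_mul]
        split_ifs with hi
        · exact hy.blockSum_apply_of_mem a hi
        · rw [Finsupp.notMem_support_iff.1 hi, mul_zero]
      have h2 : ‖embed e (restr (blockSum y a) (y k).support)‖ = |a k| := by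
        rw [h1, embed_eq, map_smul, norm_smul, ← embed_eq, hy.2.2 k, mul_one, Real.norm_eq_abs]
      rw [← h2]
      exact hS.norm_restr_mono _ (Finset.subset_biUnion_of_mem (fun k => (y k).support) hkA)
    · simp
  · refine hle.trans (add_le_add_left ?_ _)
    have hsucc : Succ fun i => (F i ∩ A).biUnion fun k => (y k).support := by
      intro i j hij m hm n hn
      obtain ⟨k, hk, hmk⟩ := Finset.mem_biUnion.1 hm
      obtain ⟨k', hk', hnk⟩ := Finset.mem_biUnion.1 hn
      exact hy.lt (hF.inter A i j hij k hk k' hk') hmk hnk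
    refine le_trans ?_ (hS.sum_norm_restr_le _ hs hsucc)
    refine mul_le_mul_of_nonneg_left (Finset.sum_le_sum fun i _ => ?_)
      (inv_nonneg.2 (schF_natCast_pos hs).le)
    rw [restr_restr, restr_restr, Finset.inter_eq_left.2
      (Finset.biUnion_subset_biUnion_of_subset_left _ Finset.inter_subset_right)]
    refine ih _ (Finset.card_lt_card ((Finset.ssubset_iff_of_subset ?_).2 ?_)) _ rfl
    · exact Finset.inter_subset_inter subset_rfl Finset.inter_subset_right
    · obtain ⟨m, hm, hmF⟩ := Finset.not_subset.1 (hsupp i)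
      rw [support_restr] at hm
      exact ⟨m, hm, fun h1 => hmF (Finset.mem_inter.1 (Finset.mem_inter.1 h1).2).1⟩

end Schlumprecht

/-- Theorem 3 of Schlumprecht: given positive reals `(ε k)` with `Σ ε k ≤ 1`,
there is a constant `C > 1` such that every normalized block basis `(y k)` of `(e i)`
admitting integers `r k ↑ ∞` with
(a) `Σᵢ ‖Eᵢ yₖ‖ ≤ 1 + ε k` for all chains `E₁ < ⋯ < E_ρ` with `ρ ≤ r (k-1)` (`k ≥ 1`), and
(b) `card (supp yₖ) ≤ ε k · f(r k / 3)`,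
is `C`-equivalent to `(e k)`. -/
theorem block_basis_C_equivalent_to_basis {S : Type*} [NormedAddCommGroup S]
    [NormedSpace ℝ S] [CompleteSpace S] (e : ℕ → S) (hS : IsSchlumprecht S e)
    (ε : ℕ → ℝ) (hεpos : ∀ k, 0 < ε k) (hεsum : Summable ε) (hεle : ∑' k, ε k ≤ 1) :
    ∃ C : ℝ, 1 < C ∧
      ∀ (y : ℕ → (ℕ →₀ ℝ)), IsNormalizedBlockBasis e y →
      ∀ r : ℕ → ℕ, Monotone r → Tendsto r atTop atTop →
      (∀ k, 1 ≤ k → ∀ ρ : ℕ, ρ ≤ r (k - 1) → ∀ E : Fin ρ → Finset ℕ, Succ E →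
        ∑ i, ‖embed e (restr (y k) (E i))‖ ≤ 1 + ε k) →
      (∀ k, ((y k).support.card : ℝ) ≤ ε k * schF ((r k : ℝ) / 3)) →
      ∃ A B : ℝ, 0 < A ∧ 0 < B ∧ A * B ≤ C ∧
        ∀ a : ℕ →₀ ℝ,
          A⁻¹ * ‖a.sum fun k c => c • embed e (y k)‖ ≤ ‖embed e a‖ ∧
          ‖embed e a‖ ≤ B * ‖a.sum fun k c => c • embed e (y k)‖ := by
  have hexp := Real.exp_pos 5606
  refine ⟨2 + 2 * Real.exp 5606, by linarith, fun y hy r hr _ ha hb => ?_⟩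
  refine ⟨2 + 2 * Real.exp 5606, 1, by linarith, one_pos, by linarith, fun a => ?_⟩
  rw [← embed_blockSum, one_mul, inv_mul_le_iff₀ (by linarith)]
  exact ⟨IsFastBlockSequence.norm_blockSum_le hS ⟨hy, hr, ha, hb⟩ hεpos hεsum hεle a,
    hy.norm_le_norm_blockSum hS a⟩
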